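/- Let f := (z₁ − 2)² − (z₂ − 3)²(z₃ − 5) ∈ ℂ[z₁,z₂,z₃]. There is a finite subset S ⊂ ℂ such that for every t ∈ ℂ with t ∉ S ∪ {0, 5}, setting P := (2, 3, t), for generic (a, a', u) ∈ ℂ³ × ℂ³ × ℂ⁴, writing ℓ₁(z) := Σ_i a_i(z_i − P_i) and ℓ₂(z) := Σ_i a'_i(z_i − P_i), the set {z ∈ (ℂ*)³ : f(z) = 0, ℓ₁(z) = 0, ℓ₂(z) ≠ 0, and there exist λ, μ ∈ ℂ with u_i/z_i + u₄·a'_i/ℓ₂(z) = λ·(∂f/∂z_i)(z) + μ·a_i for i = 1,2,3} has exactly 10 elements. (The second removal ML degree of the shifted Whitney umbrella with respect to a general point of its singular line is r₂ = 10, in contrast with the value 9 at the pinch point (2,3,5).) -/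

import Mathlib

open MvPolynomial

/-- The shifted Whitney umbrella `(z₁ − 2)² − (z₂ − 3)²(z₃ − 5)`. -/
noncomputable def umbrella : MvPolynomial (Fin 3) ℂ :=
  (X 0 - 2) ^ 2 - (X 1 - 3) ^ 2 * (X 2 - 5)

/-- Separability of a specialization of full degree is an open condition on the parameters. -/
theorem exists_ne_zero_separable_of_eval {σ K : Type*} [Field K] [CharZero K]
    (f : Polynomial (MvPolynomial σ K)) (n : ℕ) (hn : 0 < n) (hf : f.natDegree ≤ n) (p₀ : σ → K)
    (hdeg : (f.map (eval p₀)).natDegree = n) (hsep : (f.map (eval p₀)).Separable) :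
    ∃ G : MvPolynomial σ K, G ≠ 0 ∧ ∀ p, eval p G ≠ 0 →
      (f.map (eval p)).natDegree = n ∧ (f.map (eval p)).Separable := by
  have key : ∀ p, eval p (f.coeff n * f.resultant f.derivative n (n - 1)) ≠ 0 ↔
      (f.map (eval p)).natDegree = n ∧ (f.map (eval p)).Separable := by
    intro p
    rw [map_mul, mul_ne_zero_iff, ← Polynomial.resultant_map_map, ← Polynomial.derivative_map,
      ← Polynomial.coeff_map]
    have hle : (f.map (eval p)).natDegree ≤ n := Polynomial.natDegree_map_le.trans hf
    generalize f.map (eval p) = g at hle ⊢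
    have hcoeff : g.coeff n ≠ 0 ↔ g.natDegree = n := by
      refine ⟨fun h ↦ hle.antisymm (Polynomial.le_natDegree_of_ne_zero h), fun h ↦ ?_⟩
      subst h
      exact Polynomial.leadingCoeff_ne_zero.2 fun h0 ↦ by simp [h0] at hn
    rw [hcoeff]
    refine and_congr_right fun h ↦ ?_
    subst h
    rw [← Polynomial.natDegree_derivative, Ne, Polynomial.resultant_eq_zero_iff,
      Polynomial.separable_def]
    have : g ≠ 0 := fun h0 ↦ by simp [h0] at hn
    tauto
  refine ⟨_, fun h ↦ ?_, fun p hp ↦ (key p).1 hp⟩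
  exact (key p₀).2 ⟨hdeg, hsep⟩ (by rw [h, map_zero])

namespace Polynomial.Umbrella

variable {R S : Type*} [CommRing R] [CommRing S]

/-- Denominator of the parametrization of the hyperplane section by `s = (z₁ - 2) / (z₂ - 3)`. -/
noncomputable def den (a : Fin 3 → R) : R[X] := C (a 0) * X + C (a 1)

/-- The polynomial `s² - c`, whose roots parametrize the branches at the node `P`. -/
noncomputable def node (c : R) : R[X] := X ^ 2 - C c

/-- Numerator of the first coordinate of the parametrization. -/
noncomputable def num₁ (c : R) (a : Fin 3 → R) : R[X] := 2 * den a - C (a 2) * (X * node c)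

/-- Numerator of the second coordinate of the parametrization. -/
noncomputable def num₂ (c : R) (a : Fin 3 → R) : R[X] := 3 * den a - C (a 2) * node c

/-- The third coordinate of the parametrization. -/
noncomputable def num₃ : R[X] := X ^ 2 + 5

/-- The residual linear factor of the pullback of the removed linear form. -/
noncomputable def resid (a b : Fin 3 → R) : R[X] :=
  C (b 2) * den a - C (a 2) * (C (b 0) * X + C (b 1))

/-- The product of all polynomials whose zeros are removed from the parametrizing line. -/
noncomputable def polePoly (c : R) (a b : Fin 3 → R) : R[X] :=
  num₁ c a * num₂ c a * num₃ * node c * resid a b * den a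

/-- The numerator of the logarithmic derivative of the likelihood function. -/
noncomputable def critPoly (c : R) (a b : Fin 3 → R) (u : Fin 4 → R) : R[X] :=
  C (u 0) * ((derivative (num₁ c a) * den a - num₁ c a * derivative (den a)) *
      (num₂ c a * num₃ * node c * resid a b)) +
    C (u 1) * ((derivative (num₂ c a) * den a - num₂ c a * derivative (den a)) *
      (num₁ c a * num₃ * node c * resid a b)) +
    C (u 2) * (derivative num₃ * (num₁ c a * num₂ c a * node c * resid a b * den a)) +
    C (u 3) * ((derivative (node c * resid a b) * den a -
      node c * resid a b * derivative (den a)) * (num₁ c a * num₂ c a * num₃))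

theorem map_polePoly (φ : R →+* S) (c : R) (a b : Fin 3 → R) :
    (polePoly c a b).map φ = polePoly (φ c) (φ ∘ a) (φ ∘ b) := by
  simp [polePoly, num₁, num₂, num₃, node, resid, den, Polynomial.map_ofNat]

theorem map_critPoly (φ : R →+* S) (c : R) (a b : Fin 3 → R) (u : Fin 4 → R) :
    (critPoly c a b u).map φ = critPoly (φ c) (φ ∘ a) (φ ∘ b) (φ ∘ u) := by
  simp only [critPoly, Polynomial.map_add, Polynomial.map_mul, Polynomial.map_sub,
    ← derivative_map, Polynomial.map_C]
  simp [num₁, num₂, num₃, node, resid, den, Polynomial.map_ofNat]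

theorem natDegree_polePoly_le (c : R) (a b : Fin 3 → R) : (polePoly c a b).natDegree ≤ 11 := by
  unfold polePoly num₁ num₂ num₃ node resid den
  compute_degree

theorem natDegree_critPoly_le (c : R) (a b : Fin 3 → R) (u : Fin 4 → R) :
    (critPoly c a b u).natDegree ≤ 10 := by
  simp only [critPoly, num₁, num₂, num₃, node, resid, den, derivative_mul, derivative_add,
    derivative_sub, derivative_C, derivative_X, derivative_X_pow, derivative_ofNat, zero_mul,
    zero_add, add_zero, sub_zero, mul_one]
  compute_degree

theorem eval_polePoly_ne_zero_of_eval_critPoly {K : Type*} [Field K] {c : K} {a b : Fin 3 → K}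
    {u : Fin 4 → K} {s : K} (hsep : (polePoly c a b).Separable) (h₀ : u 0 ≠ 0)
    (h₁ : u 1 ≠ 0) (h₂ : u 2 ≠ 0) (h₃ : u 3 ≠ 0) (h : u 0 + u 1 + u 3 ≠ 0) (hs : (critPoly c a b u).eval s = 0) :
    (polePoly c a b).eval s ≠ 0 := by
  intro hp
  have hd : (derivative (polePoly c a b)).eval s ≠ 0 := by
    obtain ⟨p, q, hpq⟩ := hsep
    intro hd
    simpa [hp, hd] using congrArg (Polynomial.eval s) hpq
  apply hd
  simp only [polePoly, eval_mul, mul_eq_zero] at hp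
  simp only [polePoly, critPoly, derivative_mul, eval_add, eval_mul, eval_sub, eval_C] at hs ⊢
  rcases hp with ((((hp | hp) | hp) | hp) | hp) | hp
  all_goals simp only [hp] at hs ⊢
  · exact (mul_eq_zero.1 (show u 0 * _ = 0 by linear_combination hs)).resolve_left h₀
  · exact (mul_eq_zero.1 (show u 1 * _ = 0 by linear_combination hs)).resolve_left h₁
  · exact (mul_eq_zero.1 (show u 2 * _ = 0 by linear_combination hs)).resolve_left h₂
  · exact (mul_eq_zero.1 (show u 3 * _ = 0 by linear_combination hs)).resolve_left h₃
  · exact (mul_eq_zero.1 (show u 3 * _ = 0 by linear_combination hs)).resolve_left h₃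
  · exact (mul_eq_zero.1 (show (u 0 + u 1 + u 3) * _ = 0 by linear_combination -hs)).resolve_left h


/-- The parameters `t` at which the explicit choice of hyperplanes used below degenerates. -/
noncomputable def badPoly : ℂ[X] :=
  (X - 2) * (X - 6) * (X - 9) * (X - 10) * (X - 12) * (9 * X - 40) * (4 * X + 1) *
    (5 * (X - 2) ^ 2 + 4) * ((X + 3) ^ 2 + 45) * ((7 - X) ^ 3 + 27)

theorem badPoly_ne_zero : badPoly ≠ 0 := by
  intro h
  have := congrArg (eval 5) h
  norm_num [badPoly] at this

theorem isCoprime_of_eval_ne_zero {p q : ℂ[X]} (h : ∀ s, p.eval s = 0 → q.eval s ≠ 0) :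
    IsCoprime p q := by
  rw [isCoprime_iff_aeval_ne_zero_of_isAlgClosed ℂ ℂ]
  intro s
  by_cases hs : p.eval s = 0
  · exact Or.inr (by simpa using h s hs)
  · exact Or.inl (by simpa using hs)

/-- A hyperplane section for which all special points on the parametrizing line are distinct. -/
theorem separable_witness {t : ℂ} (ht : badPoly.eval t ≠ 0) (h₀ : t ≠ 0) (h₅ : t ≠ 5) :
    (X * polePoly (t - 5) ![1, -1, -1] ![1, -2, 0] : ℂ[X]).Separable := by
  obtain ⟨c, rfl⟩ : ∃ c, t = c + 5 := ⟨t - 5, by ring⟩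
  have hE : node (c + 5 - 5) = X ^ 2 - C c := by simp [node]
  have hD : den ![(1 : ℂ), -1, -1] = X - 1 := by simp [den, sub_eq_add_neg]
  have hN1 : num₁ (c + 5 - 5) ![(1 : ℂ), -1, -1] = X ^ 3 + (2 - C c) * X - 2 := by
    rw [num₁, hE, hD]; simp; ring
  have hN2 : num₂ (c + 5 - 5) ![(1 : ℂ), -1, -1] = X ^ 2 + 3 * X - 3 - C c := by
    rw [num₂, hE, hD]; simp; ring
  have hL : resid ![(1 : ℂ), -1, -1] ![1, -2, 0] = X - 2 := by
    simp [resid, sub_eq_add_neg, C_ofNat]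
  rw [polePoly, hN1, hN2, hE, hL, hD, num₃]
  simp only [badPoly, eval_mul, eval_add, eval_sub, eval_pow, eval_X, eval_ofNat, eval_one,
    ne_eq, mul_eq_zero, not_or] at ht
  obtain ⟨⟨⟨⟨⟨⟨⟨⟨⟨hb₁, hb₂⟩, hb₃⟩, hb₄⟩, hb₅⟩, hb₆⟩, hb₇⟩, hb₈⟩, hb₉⟩, hb₁₀⟩ := ht
  have hc : c ≠ 0 := fun h ↦ h₅ (by simp [h])
  have hX : IsCoprime X ((X ^ 3 + (2 - C c) * X - 2) * (X ^ 2 + 3 * X - 3 - C c) * (X ^ 2 + 5) *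
      (X ^ 2 - C c) * (X - 2) * (X - 1) : ℂ[X]) := by
    refine isCoprime_of_eval_ne_zero fun s hs h ↦ ?_
    obtain rfl : s = 0 := by simpa using hs
    simp only [eval_mul, eval_add, eval_sub, eval_pow, eval_X, eval_C, eval_ofNat,
      eval_one, mul_eq_zero] at h
    rcases h with ((((h | h) | h) | h) | h) | h
    · norm_num at h
    · exact hb₁ (by linear_combination -h)
    · norm_num at h
    · exact hc (by linear_combination -h)
    · norm_num at h
    · norm_num at h
  have hD : IsCoprime ((X ^ 3 + (2 - C c) * X - 2) * (X ^ 2 + 3 * X - 3 - C c) * (X ^ 2 + 5) *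
      (X ^ 2 - C c) * (X - 2)) (X - 1 : ℂ[X]) := by
    refine (isCoprime_of_eval_ne_zero fun s hs h ↦ ?_).symm
    obtain rfl : s = 1 := by simpa [sub_eq_zero] using hs
    simp only [eval_mul, eval_add, eval_sub, eval_pow, eval_X, eval_C, eval_ofNat,
      mul_eq_zero] at h
    rcases h with (((h | h) | h) | h) | h
    · exact hb₂ (by linear_combination -h)
    · exact hb₂ (by linear_combination -h)
    · norm_num at h
    · exact hb₂ (by linear_combination -h)
    · norm_num at h
  have hL : IsCoprime ((X ^ 3 + (2 - C c) * X - 2) * (X ^ 2 + 3 * X - 3 - C c) * (X ^ 2 + 5) *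
      (X ^ 2 - C c)) (X - 2 : ℂ[X]) := by
    refine (isCoprime_of_eval_ne_zero fun s hs h ↦ ?_).symm
    obtain rfl : s = 2 := by simpa [sub_eq_zero] using hs
    simp only [eval_mul, eval_add, eval_sub, eval_pow, eval_X, eval_C, eval_ofNat,
      mul_eq_zero] at h
    rcases h with ((h | h) | h) | h
    · exact hb₄ (by linear_combination -h / 2)
    · exact hb₅ (by linear_combination -h)
    · norm_num at h
    · exact hb₃ (by linear_combination -h)
  have hE : IsCoprime ((X ^ 3 + (2 - C c) * X - 2) * (X ^ 2 + 3 * X - 3 - C c) * (X ^ 2 + 5))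
      (X ^ 2 - C c : ℂ[X]) := by
    refine (isCoprime_of_eval_ne_zero fun s hs h ↦ ?_).symm
    simp only [eval_mul, eval_add, eval_sub, eval_pow, eval_X, eval_C, eval_ofNat,
      mul_eq_zero] at hs h
    rcases h with (h | h) | h
    · have hs₁ : s = 1 := by linear_combination h / 2 - s / 2 * hs
      exact hb₂ (by linear_combination -hs + (s + 1) * hs₁)
    · have hs₁ : s = 1 := by linear_combination (h - hs) / 3
      exact hb₂ (by linear_combination -hs + (s + 1) * hs₁)
    · exact h₀ (by linear_combination h - hs)
  have hN3 : IsCoprime ((X ^ 3 + (2 - C c) * X - 2) * (X ^ 2 + 3 * X - 3 - C c))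
      (X ^ 2 + 5 : ℂ[X]) := by
    refine (isCoprime_of_eval_ne_zero fun s hs h ↦ ?_).symm
    simp only [eval_mul, eval_add, eval_sub, eval_pow, eval_X, eval_C, eval_ofNat,
      mul_eq_zero] at hs h
    rcases h with h | h
    · exact hb₈ (by linear_combination (c + 3) ^ 2 * hs - ((c + 3) * s - 2) * (s * hs - h))
    · exact hb₉ (by linear_combination 9 * hs - (3 * s + (c + 8)) * (h - hs))
  have hN2 : IsCoprime (X ^ 3 + (2 - C c) * X - 2) (X ^ 2 + 3 * X - 3 - C c : ℂ[X]) := by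
    refine (isCoprime_of_eval_ne_zero fun s hs h ↦ ?_).symm
    simp only [eval_mul, eval_add, eval_sub, eval_pow, eval_X, eval_C, eval_ofNat] at hs h
    rcases mul_eq_zero.1 (show (3 * s - 2) * (s - 1) = 0 by linear_combination s * hs - h)
      with hs₁ | hs₁
    · exact hb₆ (by linear_combination -9 * hs + (3 * s + 11) * hs₁)
    · exact hb₂ (by linear_combination -hs + (s + 4) * hs₁)
  have sN1 : (X ^ 3 + (2 - C c) * X - 2 : ℂ[X]).Separable := by
    refine isCoprime_of_eval_ne_zero fun s hs h ↦ ?_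
    replace h : 3 * s ^ 2 + (2 - c) = 0 := by
      simp at h
      linear_combination h
    simp only [eval_mul, eval_add, eval_sub, eval_pow, eval_X, eval_C, eval_ofNat] at hs
    exact hb₁₀ (by linear_combination ((2 - c) ^ 2 - 3 * (2 - c) * s ^ 2 + 9 * s ^ 4) * h -
      27 * (s ^ 3 - 1) * ((s * h - hs) / 2))
  have sN2 : (X ^ 2 + 3 * X - 3 - C c : ℂ[X]).Separable := by
    refine isCoprime_of_eval_ne_zero fun s hs h ↦ ?_
    replace h : 2 * s + 3 = 0 := by
      simp at h
      linear_combination h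
    simp only [eval_mul, eval_add, eval_sub, eval_pow, eval_X, eval_C, eval_ofNat] at hs
    exact hb₇ (by linear_combination -4 * hs + (2 * s + 3) * h)
  have sN3 : (X ^ 2 + 5 : ℂ[X]).Separable := by
    refine isCoprime_of_eval_ne_zero fun s hs h ↦ ?_
    obtain rfl : s = 0 := by simpa using h
    norm_num at hs
  have sE : (X ^ 2 - C c : ℂ[X]).Separable := by
    refine isCoprime_of_eval_ne_zero fun s hs h ↦ ?_
    obtain rfl : s = 0 := by simpa using h
    exact hc (by simpa using hs)
  have sL : (X - 2 : ℂ[X]).Separable := by simpa [C_ofNat] using separable_X_sub_C (x := (2 : ℂ))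
  have sD : (X - 1 : ℂ[X]).Separable := by simpa using separable_X_sub_C (x := (1 : ℂ))
  exact separable_X.mul
    (((((sN1.mul sN2 hN2).mul sN3 hN3).mul sE hE).mul sL hL).mul sD hD) hX


theorem natDegree_polePoly_witness (c : ℂ) :
    (polePoly c ![1, -1, -1] ![1, -2, 0]).natDegree = 11 := by
  simp only [polePoly, num₁, num₂, num₃, node, resid, den]
  compute_degree!
  simp

theorem critPoly_witness_mul (c : ℂ) :
    critPoly c ![1, -1, -1] ![1, -2, 0] ![0, 0, 1, 0] * num₃ =
      C 2 * (X * polePoly c ![1, -1, -1] ![1, -2, 0]) := by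
  have : derivative (num₃ : ℂ[X]) = C 2 * X := by
    simp [num₃, one_add_one_eq_two, C_ofNat]
  simp [critPoly, polePoly, this]
  ring

theorem natDegree_critPoly_witness (c : ℂ) :
    (critPoly c ![1, -1, -1] ![1, -2, 0] ![0, 0, 1, 0]).natDegree = 10 := by
  have h₃ : (num₃ : ℂ[X]).natDegree = 2 := by
    rw [num₃]
    compute_degree!
  have hp := natDegree_polePoly_witness c
  have h := congrArg natDegree (critPoly_witness_mul c)
  rw [natDegree_C_mul (by norm_num), natDegree_X_mul (by rintro h0; simp [h0] at hp), hp,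
    natDegree_mul _ (by rintro h0; simp [h0] at h₃), h₃] at h
  · omega
  · intro h0
    have := critPoly_witness_mul c
    rw [h0, zero_mul, eq_comm] at this
    simp at this
    simp [this] at hp

/-- The pole polynomial and the critical polynomial are separable of the expected degree for
generic parameters. -/
theorem exists_generic {t : ℂ} (ht : badPoly.eval t ≠ 0) (h₀ : t ≠ 0) (h₅ : t ≠ 5) :
    ∃ G : MvPolynomial (Fin 3 ⊕ Fin 3 ⊕ Fin 4) ℂ, G ≠ 0 ∧
      ∀ (a b : Fin 3 → ℂ) (u : Fin 4 → ℂ), MvPolynomial.eval (Sum.elim a (Sum.elim b u)) G ≠ 0 →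
        (polePoly (t - 5) a b).Separable ∧ (critPoly (t - 5) a b u).natDegree = 10 ∧
          (critPoly (t - 5) a b u).Separable ∧ a 2 ≠ 0 ∧ (∀ i, u i ≠ 0) ∧
            u 0 + u 1 + u 3 ≠ 0 := by
  have hsep := separable_witness ht h₀ h₅
  let A : Fin 3 → MvPolynomial (Fin 3 ⊕ Fin 3 ⊕ Fin 4) ℂ := fun i ↦ .X (.inl i)
  let B : Fin 3 → MvPolynomial (Fin 3 ⊕ Fin 3 ⊕ Fin 4) ℂ := fun i ↦ .X (.inr (.inl i))
  let U : Fin 4 → MvPolynomial (Fin 3 ⊕ Fin 3 ⊕ Fin 4) ℂ := fun i ↦ .X (.inr (.inr i))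
  have hA (a b : Fin 3 → ℂ) (u : Fin 4 → ℂ) :
      MvPolynomial.eval (Sum.elim a (Sum.elim b u)) ∘ A = a := by ext; simp [A]
  have hB (a b : Fin 3 → ℂ) (u : Fin 4 → ℂ) :
      MvPolynomial.eval (Sum.elim a (Sum.elim b u)) ∘ B = b := by ext; simp [B]
  have hU (a b : Fin 3 → ℂ) (u : Fin 4 → ℂ) :
      MvPolynomial.eval (Sum.elim a (Sum.elim b u)) ∘ U = u := by ext; simp [U]
  let p₀ : Fin 3 ⊕ Fin 3 ⊕ Fin 4 → ℂ :=
    Sum.elim ![1, -1, -1] (Sum.elim ![1, -2, 0] ![0, 0, 1, 0])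
  obtain ⟨G₁, hG₁, H₁⟩ := exists_ne_zero_separable_of_eval
    (polePoly (MvPolynomial.C (t - 5)) A B) 11 (by norm_num) (natDegree_polePoly_le _ _ _) p₀
    (by rw [map_polePoly, hA, hB, MvPolynomial.eval_C, natDegree_polePoly_witness])
    (by rw [map_polePoly, hA, hB, MvPolynomial.eval_C]; exact hsep.of_mul_right)
  obtain ⟨G₂, hG₂, H₂⟩ := exists_ne_zero_separable_of_eval
    (critPoly (MvPolynomial.C (t - 5)) A B U) 10 (by norm_num) (natDegree_critPoly_le _ _ _ _) p₀
    (by rw [map_critPoly, hA, hB, hU, MvPolynomial.eval_C, natDegree_critPoly_witness])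
    (by
      rw [map_critPoly, hA, hB, hU, MvPolynomial.eval_C]
      refine Separable.of_mul_left (g := num₃) ?_
      rw [critPoly_witness_mul]
      exact hsep.unit_mul (isUnit_C.2 (by norm_num)))
  have hsum : U 0 + U 1 + U 3 ≠ 0 := fun h ↦ by
    have := congrArg (MvPolynomial.eval 1) h
    norm_num [U] at this
  refine ⟨G₁ * G₂ * A 2 * (∏ i, U i) * (U 0 + U 1 + U 3), ?_, fun a b u h ↦ ?_⟩
  · simp only [mul_ne_zero_iff, Finset.prod_ne_zero_iff]
    exact ⟨⟨⟨⟨hG₁, hG₂⟩, MvPolynomial.X_ne_zero _⟩, fun _ _ ↦ MvPolynomial.X_ne_zero _⟩, hsum⟩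
  · simp only [map_mul, map_prod, mul_ne_zero_iff, Finset.prod_ne_zero_iff] at h
    obtain ⟨⟨⟨⟨h₁, h₂⟩, ha⟩, hu⟩, hs⟩ := h
    have k₁ := H₁ _ h₁
    have k₂ := H₂ _ h₂
    rw [map_polePoly, hA, hB, MvPolynomial.eval_C] at k₁
    rw [map_critPoly, hA, hB, hU, MvPolynomial.eval_C] at k₂
    exact ⟨k₁.2, k₂.1, k₂.2, by simpa [A] using ha, fun i ↦ by simpa [U] using hu i (by simp),
      by simpa [U] using hs⟩

/-- Elimination of the Lagrange multipliers at the point with parameter `s`. -/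
theorem exists_multipliers_iff {a v : Fin 3 → ℂ} {s y : ℂ} (hy : y ≠ 0) (hD : a 0 * s + a 1 ≠ 0) :
    (∃ lam mu : ℂ, v 0 = lam * (2 * (s * y)) + mu * a 0 ∧
      v 1 = lam * (-(2 * y * s ^ 2)) + mu * a 1 ∧ v 2 = lam * (-y ^ 2) + mu * a 2) ↔
      v 0 * (y * a 1 - 2 * s ^ 2 * a 2) + v 1 * (-(y * a 0) - 2 * s * a 2) +
        v 2 * (2 * s * (a 0 * s + a 1)) = 0 := by
  constructor
  · rintro ⟨lam, mu, h₀, h₁, h₂⟩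
    rw [h₀, h₁, h₂]
    ring
  · intro h
    by_cases hs : s = 0
    · subst hs
      simp only [mul_zero, zero_add] at hD
      have h' : v 0 * a 1 = v 1 * a 0 := mul_left_cancel₀ hy (by linear_combination h)
      refine ⟨(v 1 / a 1 * a 2 - v 2) / y ^ 2, v 1 / a 1, ?_, ?_, ?_⟩
      · field_simp
        linear_combination y * h'
      · field_simp
        ring
      · field_simp
        ring
    · refine ⟨(v 0 * a 1 - v 1 * a 0) / (2 * s * y * (a 0 * s + a 1)),
        (v 1 + s * v 0) / (a 0 * s + a 1), ?_, ?_, ?_⟩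
      · field_simp
        ring
      · field_simp
        ring
      · field_simp
        linear_combination h

/-- The critical polynomial in terms of the parametrized point. -/
theorem eval_critPoly {c s y : ℂ} {a b : Fin 3 → ℂ} {u : Fin 4 → ℂ}
    (hy : y * (a 0 * s + a 1) = -a 2 * (s ^ 2 - c)) :
    (critPoly c a b u).eval s = (a 0 * s + a 1) ^ 3 *
      (u 0 * (3 + y) * (s ^ 2 + 5) * (b 0 * (s * y) + b 1 * y + b 2 * (s ^ 2 - c)) *
          (y * a 1 - 2 * s ^ 2 * a 2) +
        u 1 * (2 + s * y) * (s ^ 2 + 5) * (b 0 * (s * y) + b 1 * y + b 2 * (s ^ 2 - c)) *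
          (-(y * a 0) - 2 * s * a 2) +
        u 2 * (2 + s * y) * (3 + y) * (b 0 * (s * y) + b 1 * y + b 2 * (s ^ 2 - c)) *
          (2 * s * (a 0 * s + a 1)) +
        u 3 * (2 + s * y) * (3 + y) * (s ^ 2 + 5) * (b 0 * (y * a 1 - 2 * s ^ 2 * a 2) +
          b 1 * (-(y * a 0) - 2 * s * a 2) + b 2 * (2 * s * (a 0 * s + a 1)))) := by
  have hD : (den a).eval s = a 0 * s + a 1 := by simp [den]
  have hN₁ : (num₁ c a).eval s = (a 0 * s + a 1) * (2 + s * y) := by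
    simp [num₁, den, node]
    linear_combination -s * hy
  have hN₂ : (num₂ c a).eval s = (a 0 * s + a 1) * (3 + y) := by
    simp [num₂, den, node]
    linear_combination -hy
  have hN₃ : (num₃ : ℂ[X]).eval s = s ^ 2 + 5 := by simp [num₃]
  have hL : (node c).eval s * (resid a b).eval s =
      (a 0 * s + a 1) * (b 0 * (s * y) + b 1 * y + b 2 * (s ^ 2 - c)) := by
    simp [node, resid, den]
    linear_combination -(b 0 * s + b 1) * hy
  have dN₁ : (derivative (num₁ c a) * den a - num₁ c a * derivative (den a)).eval s =
      (a 0 * s + a 1) * (y * a 1 - 2 * s ^ 2 * a 2) := by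
    simp [num₁, den, node]
    linear_combination -a 1 * hy
  have dN₂ : (derivative (num₂ c a) * den a - num₂ c a * derivative (den a)).eval s =
      (a 0 * s + a 1) * (-(y * a 0) - 2 * s * a 2) := by
    simp [num₂, den, node]
    linear_combination a 0 * hy
  have dN₃ : (derivative num₃ : ℂ[X]).eval s = 2 * s := by
    simp [num₃, one_add_one_eq_two]
  have dL : (derivative (node c * resid a b) * den a -
      node c * resid a b * derivative (den a)).eval s =
      (a 0 * s + a 1) * (b 0 * (y * a 1 - 2 * s ^ 2 * a 2) +
          b 1 * (-(y * a 0) - 2 * s * a 2) + b 2 * (2 * s * (a 0 * s + a 1))) := by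
    simp [node, resid, den]
    linear_combination (b 1 * a 0 - b 0 * a 1) * hy
  simp only [critPoly, eval_add, eval_mul, eval_C, dN₁, dN₂, dN₃, dL, hN₁, hN₂, hN₃, hD]
  generalize (node c).eval s = E at hL ⊢
  generalize (resid a b).eval s = L at hL ⊢
  linear_combination (a 0 * s + a 1) ^ 2 *
    (u 0 * (y * a 1 - 2 * s ^ 2 * a 2) * (3 + y) * (s ^ 2 + 5) +
      u 1 * (-(y * a 0) - 2 * s * a 2) * (2 + s * y) * (s ^ 2 + 5) +
      u 2 * (2 * s) * (2 + s * y) * (3 + y) * (a 0 * s + a 1)) * hL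

end Polynomial.Umbrella

theorem eval_umbrella (z : Fin 3 → ℂ) :
    eval z umbrella = (z 0 - 2) ^ 2 - (z 1 - 3) ^ 2 * (z 2 - 5) := by
  simp [umbrella]

theorem eval_pderiv_umbrella (z : Fin 3 → ℂ) :
    eval z (pderiv 0 umbrella) = 2 * (z 0 - 2) ∧
      eval z (pderiv 1 umbrella) = -(2 * (z 1 - 3) * (z 2 - 5)) ∧
        eval z (pderiv 2 umbrella) = -(z 1 - 3) ^ 2 := by
  have h (i : Fin 3) (n : ℕ) [n.AtLeastTwo] :
      pderiv i (OfNat.ofNat n : MvPolynomial (Fin 3) ℂ) = 0 := by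
    rw [← map_ofNat C n, pderiv_C]
  refine ⟨?_, ?_, ?_⟩ <;> simp [umbrella, pderiv_X, h]
  ring

open Polynomial.Umbrella in
/-- Critical points with `z₂ ≠ 3` in terms of the parameter `s = (z₁ - 2) / (z₂ - 3)`. -/
theorem exists_multipliers_iff_eval_critPoly {t s y : ℂ} {a b : Fin 3 → ℂ} {u : Fin 4 → ℂ}
    {z : Fin 3 → ℂ} (hy₀ : y ≠ 0) (hD : a 0 * s + a 1 ≠ 0)
    (hy : y * (a 0 * s + a 1) = -a 2 * (s ^ 2 - (t - 5))) (hz : ∀ i, z i ≠ 0)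
    (hz₀ : z 0 = 2 + s * y) (hz₁ : z 1 = 3 + y) (hz₂ : z 2 = s ^ 2 + 5)
    (hl : (∑ j, b j * (z j - (![2, 3, t] : Fin 3 → ℂ) j)) ≠ 0) :
    (∃ lam mu : ℂ, ∀ i : Fin 3, u i.castSucc / z i
        + u 3 * b i / (∑ j, b j * (z j - (![2, 3, t] : Fin 3 → ℂ) j))
          = lam * eval z (pderiv i umbrella) + mu * a i) ↔
      (critPoly (t - 5) a b u).eval s = 0 := by
  have hsum : (∑ j, b j * (z j - (![2, 3, t] : Fin 3 → ℂ) j)) =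
      b 0 * (s * y) + b 1 * y + b 2 * (s ^ 2 - (t - 5)) := by
    simp [Fin.sum_univ_three, hz₀, hz₁, hz₂]
    exact Or.inl (by ring)
  obtain ⟨g₀, g₁, g₂⟩ := eval_pderiv_umbrella z
  have e₀ : 2 * (z 0 - 2) = 2 * (s * y) := by rw [hz₀]; ring
  have e₁ : -(2 * (z 1 - 3) * (z 2 - 5)) = -(2 * y * s ^ 2) := by rw [hz₁, hz₂]; ring
  have e₂ : -(z 1 - 3) ^ 2 = -y ^ 2 := by rw [hz₁]; ring
  have hlag := exists_multipliers_iff (a := a) (s := s) (y := y)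
    (v := fun i ↦ u i.castSucc / z i +
      u 3 * b i / (∑ j, b j * (z j - (![2, 3, t] : Fin 3 → ℂ) j))) hy₀ hD
  simp only [Fin.forall_fin_succ, Fin.succ_zero_eq_one, Fin.succ_one_eq_two, IsEmpty.forall_iff,
    and_true, g₀, g₁, g₂, e₀, e₁, e₂]
  rw [hlag, eval_critPoly hy, ← hsum, ← hz₀, ← hz₁, ← hz₂]
  have h₀ := hz 0
  have h₁ := hz 1
  have h₂ := hz 2
  generalize (∑ j, b j * (z j - (![2, 3, t] : Fin 3 → ℂ) j)) = l at hl ⊢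
  rw [mul_eq_zero_iff_left (pow_ne_zero 3 hD)]
  simp only [Fin.castSucc_zero, Fin.castSucc_one, show (2 : Fin 3).castSucc = 2 from rfl]
  rw [← mul_eq_zero_iff_left (mul_ne_zero (mul_ne_zero (mul_ne_zero h₀ h₁) h₂) hl)]
  refine Eq.congr ?_ rfl
  field_simp
  ring

open Polynomial.Umbrella in
/-- **The second removal ML degree of the shifted Whitney umbrella with respect to a
general point of its singular line is `r₂ = 10`.**  There is a finite set `S ⊂ ℂ` such
that for every `t ∉ S ∪ {0, 5}`, setting `P = (2, 3, t)`, for generic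
`(a, a', u) ∈ ℂ³ × ℂ³ × ℂ⁴`, writing `ℓ₁(z) = Σᵢ aᵢ(zᵢ − Pᵢ)` and
`ℓ₂(z) = Σᵢ a'ᵢ(zᵢ − Pᵢ)`, there are exactly `10` ML-critical points of the umbrella
on the hyperplane section `ℓ₁ = 0` with the hyperplane `ℓ₂` removed. -/
theorem umbrella_removal_ml_degree_two_general :
    ∃ S : Set ℂ, S.Finite ∧
      ∀ t : ℂ, t ∉ S → t ≠ 0 → t ≠ 5 →
        ∃ G : MvPolynomial (Fin 3 ⊕ Fin 3 ⊕ Fin 4) ℂ, G ≠ 0 ∧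
          ∀ (a a' : Fin 3 → ℂ) (u : Fin 4 → ℂ), eval (Sum.elim a (Sum.elim a' u)) G ≠ 0 →
            {z : Fin 3 → ℂ | (∀ i, z i ≠ 0) ∧ eval z umbrella = 0 ∧
                (∑ i, a i * (z i - (![2, 3, t] : Fin 3 → ℂ) i)) = 0 ∧
                (∑ i, a' i * (z i - (![2, 3, t] : Fin 3 → ℂ) i)) ≠ 0 ∧
                ∃ lam mu : ℂ, ∀ i : Fin 3,
                  u i.castSucc / z i
                      + u 3 * a' i / (∑ j, a' j * (z j - (![2, 3, t] : Fin 3 → ℂ) j))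
                    = lam * eval z (pderiv i umbrella) + mu * a i}.ncard = 10 := by
  refine ⟨{t | badPoly.IsRoot t}, Polynomial.finite_setOfPred_isRoot badPoly_ne_zero,
    fun t ht h₀ h₅ ↦ ?_⟩
  obtain ⟨G, hG, H⟩ := exists_generic ht h₀ h₅
  refine ⟨G, hG, fun a b u hp ↦ ?_⟩
  obtain ⟨hpole, hdeg, hsep, ha, hu, hus⟩ := H a b u hp
  set Q := critPoly (t - 5) a b u with hQ
  have hQ₀ : Q ≠ 0 := hsep.ne_zero
  let y : ℂ → ℂ := fun s ↦ -a 2 * (s ^ 2 - (t - 5)) / (a 0 * s + a 1)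
  let φ : ℂ → Fin 3 → ℂ := fun s ↦ ![2 + s * y s, 3 + y s, s ^ 2 + 5]
  have hfac (s : ℂ) (hs : Q.eval s = 0) :
      a 0 * s + a 1 ≠ 0 ∧ s ^ 2 - (t - 5) ≠ 0 ∧ (resid a b).eval s ≠ 0 ∧ s ^ 2 + 5 ≠ 0 ∧
        3 + y s ≠ 0 ∧ 2 + s * y s ≠ 0 := by
    have h := eval_polePoly_ne_zero_of_eval_critPoly hpole (hu 0) (hu 1) (hu 2) (hu 3) hus hs
    simp only [polePoly, Polynomial.eval_mul, mul_ne_zero_iff] at h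
    obtain ⟨⟨⟨⟨⟨h₁, h₂⟩, h₃⟩, hE⟩, hL⟩, hD⟩ := h
    simp [den] at hD
    simp [node] at hE
    simp [num₃] at h₃
    simp [num₂, den, node] at h₂
    simp [num₁, den, node] at h₁
    have hyD : y s * (a 0 * s + a 1) = -a 2 * (s ^ 2 - (t - 5)) := div_mul_cancel₀ _ hD
    refine ⟨hD, hE, hL, h₃, fun h ↦ h₂ ?_, fun h ↦ h₁ ?_⟩
    · linear_combination (a 0 * s + a 1) * h - hyD
    · linear_combination (a 0 * s + a 1) * h - s * hyD
  have hy₀ (s : ℂ) (hs : Q.eval s = 0) : y s ≠ 0 := by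
    obtain ⟨hD, hE, -⟩ := hfac s hs
    exact div_ne_zero (mul_ne_zero (neg_ne_zero.2 ha) hE) hD
  have himage : {z : Fin 3 → ℂ | (∀ i, z i ≠ 0) ∧ eval z umbrella = 0 ∧
      (∑ i, a i * (z i - (![2, 3, t] : Fin 3 → ℂ) i)) = 0 ∧
      (∑ i, b i * (z i - (![2, 3, t] : Fin 3 → ℂ) i)) ≠ 0 ∧
      ∃ lam mu : ℂ, ∀ i : Fin 3, u i.castSucc / z i
          + u 3 * b i / (∑ j, b j * (z j - (![2, 3, t] : Fin 3 → ℂ) j))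
        = lam * eval z (pderiv i umbrella) + mu * a i} = φ '' (Q.roots.toFinset : Set ℂ) := by
    ext z
    simp only [Set.mem_ofPred_eq, Set.mem_image, Finset.mem_coe, Multiset.mem_toFinset,
      Polynomial.mem_roots hQ₀, Polynomial.IsRoot.def]
    constructor
    · rintro ⟨hz, hf, hl₁, hl₂, hcrit⟩
      rw [eval_umbrella] at hf
      have hl₁' := hl₁
      simp [Fin.sum_univ_three] at hl₁'
      have hy : z 1 - 3 ≠ 0 := by
        intro hy
        have hx : z 0 - 2 = 0 := by simpa [hy] using hf
        have hw : z 2 - t = 0 := by simpa [hx, hy, ha] using hl₁'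
        apply hl₂
        simp [Fin.sum_univ_three, hx, hy, hw]
      obtain ⟨s, hs⟩ : ∃ s, z 0 - 2 = s * (z 1 - 3) := ⟨(z 0 - 2) / (z 1 - 3), by field_simp⟩
      have hs₂ : z 2 = s ^ 2 + 5 :=
        mul_left_cancel₀ (pow_ne_zero 2 hy)
          (by rw [hs] at hf; linear_combination -hf)
      have hyD : (z 1 - 3) * (a 0 * s + a 1) = -a 2 * (s ^ 2 - (t - 5)) := by
        rw [hs, hs₂] at hl₁'
        linear_combination hl₁'
      have hD : a 0 * s + a 1 ≠ 0 := by
        intro hD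
        have hE : s ^ 2 - (t - 5) = 0 := by simpa [hD, ha] using hyD
        obtain ⟨p, q, hpq⟩ := hpole
        have := congrArg (Polynomial.eval s) hpq
        simp [polePoly, show (den a).eval s = 0 by simpa [den] using hD,
          show (node (t - 5)).eval s = 0 by simpa [node] using hE] at this
      have hys : y s = z 1 - 3 := by
        simp only [y]
        rw [← hyD, mul_div_cancel_right₀ _ hD]
      refine ⟨s, ?_, ?_⟩
      · exact (exists_multipliers_iff_eval_critPoly hy hD hyD hz (by linear_combination hs)
          (by ring) hs₂ hl₂).1 hcrit
      · ext i
        fin_cases i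
        · simp only [φ, hys]
          simp
          linear_combination -hs
        · simp [φ, hys]
        · simp [φ, hs₂]
    · rintro ⟨s, hs, rfl⟩
      obtain ⟨hD, hE, hL, h₃, h₂, h₁⟩ := hfac s hs
      have hyD : y s * (a 0 * s + a 1) = -a 2 * (s ^ 2 - (t - 5)) := div_mul_cancel₀ _ hD
      have hz : ∀ i, φ s i ≠ 0 := by
        intro i
        fin_cases i
        · exact h₁
        · exact h₂
        · exact h₃
      have hl : (∑ i, b i * (φ s i - (![2, 3, t] : Fin 3 → ℂ) i)) ≠ 0 := by
        refine right_ne_zero_of_mul (a := a 0 * s + a 1) ?_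
        convert mul_ne_zero hE hL using 1
        simp [Fin.sum_univ_three, φ, resid, den]
        linear_combination (b 0 * s + b 1) * hyD
      refine ⟨hz, ?_, ?_, hl, ?_⟩
      · rw [eval_umbrella]
        simp [φ]
        ring
      · simp [Fin.sum_univ_three, φ]
        linear_combination hyD
      · exact (exists_multipliers_iff_eval_critPoly (hy₀ s hs) hD hyD hz rfl rfl rfl hl).2 hs
  rw [himage, Set.InjOn.ncard_image, Set.ncard_coe_finset,
    Multiset.toFinset_card_of_nodup (Polynomial.nodup_roots hsep),
    ← (IsAlgClosed.splits Q).natDegree_eq_card_roots, hdeg]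
  intro s hs r hr h
  simp only [Finset.mem_coe, Multiset.mem_toFinset, Polynomial.mem_roots hQ₀,
    Polynomial.IsRoot.def] at hs hr
  have e₀ : 2 + s * y s = 2 + r * y r := congrFun h 0
  have e₁ : 3 + y s = 3 + y r := congrFun h 1
  exact mul_right_cancel₀ (hy₀ s hs) (by linear_combination e₀ - r * e₁)
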